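/- Let k ≥ 3 and t ≥ k−2, and let F_t^{(k)} be the k-graph formed by the three tight k-uniform paths (a_1,…,a_{k−1},b_0,…,b_t,c_t), (a_1,…,a_{k−1},c_0,…,c_t,d_t), (a_1,…,a_{k−1},d_0,…,d_t,b_t). Set e₁ = {d_{t−k+2},…,d_t, b_t} and let F₁ be the spanning subhypergraph with single edge e₁ and F₂ = F_t^{(k)} − e₁. Then for every pair i < j in [k] there exists an ordering of V(F_t^{(k)}) that is vanishing for both F₁ and F₂ and under which the (k−1)-set S = {d_{t−k+2},…,d_t} is i-type with respect to F₁ and j-type with respect to F₂. -/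

import Mathlib

open scoped Classical BigOperators

noncomputable section

/-- The rank (number of elements of `e` smaller under `ord`) of `x` in the finset `e`. -/
def rankIn {V : Type*} [DecidableEq V] (ord : V → ℕ) (e : Finset V) (x : V) : ℕ :=
  (e.filter (fun y => ord y < ord x)).card

/-- `F` is vanishing w.r.t. the vertex ordering induced by `ord`: the shadow `∂F` can be
partitioned into `k` classes `𝒞_1, …, 𝒞_k` (encoded by `C : Finset V → ℕ` with values
`< k`, class `ℓ` corresponding to value `ℓ − 1`) such that for every edge `e` and every
`x ∈ e`, the `(k−1)`-set `e ∖ {x}` lies in the class indexed by the rank of `x` in `e`. -/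
def IsVanishing {V : Type*} [DecidableEq V] (k : ℕ) (F : Finset (Finset V))
    (ord : V → ℕ) : Prop :=
  ∃ C : Finset V → ℕ, (∀ S, C S < k) ∧ ∀ e ∈ F, ∀ x ∈ e, C (e.erase x) = rankIn ord e x

/-- `F` has a vanishing ordering of its vertex set. -/
def HasVanishingOrdering {V : Type*} [DecidableEq V] (k : ℕ)
    (F : Finset (Finset V)) : Prop :=
  ∃ ord : V → ℕ, Function.Injective ord ∧ IsVanishing k F ord

/-- The vertex set of `F_t^{(k)}`: the vertices `a_1, …, a_{k−1}` (left summand) and the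
vertices `x_r` for `x ∈ {b, c, d}` (encoded `0, 1, 2 : Fin 3`) and `0 ≤ r ≤ t`. -/
abbrev Vtx (k t : ℕ) := Fin (k - 1) ⊕ (Fin 3 × Fin (t + 1))

/-- The `i`-th vertex (0-based) of the tight path
`(a_1, …, a_{k−1}, x_0, x_1, …, x_t, (x+1)_t)` of `F_t^{(k)}`, for `x ∈ {b, c, d}`. -/
def pathSeq (k t : ℕ) (x : Fin 3) (i : ℕ) : Vtx k t :=
  if h : i < k - 1 then Sum.inl ⟨i, h⟩
  else if h2 : i < k - 1 + (t + 1) then Sum.inr (x, ⟨i - (k - 1), by omega⟩)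
  else Sum.inr (x + 1, Fin.last t)

/-- The `k`-graph `F_t^{(k)}`: the union of the edges of the three tight `k`-uniform
paths `(a_1,…,a_{k−1},b_0,…,b_t,c_t)`, `(a_1,…,a_{k−1},c_0,…,c_t,d_t)` and
`(a_1,…,a_{k−1},d_0,…,d_t,b_t)`, each of length `t+k+1`; the edge starting at position
`i` (for `0 ≤ i ≤ t+1`) consists of the `k` consecutive vertices at positions
`i, …, i+k−1`. -/
def Fkt (k t : ℕ) : Finset (Finset (Vtx k t)) :=
  Finset.univ.image (fun p : Fin 3 × Fin (t + 2) =>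
    (Finset.range k).image (fun j => pathSeq k t p.1 ((p.2 : ℕ) + j)))
/-- Under the ordering `ord`, the `(k−1)`-set `S` is `ℓ`-type w.r.t. the hypergraph `G`
(`ℓ ∈ [k]`, 1-based): there is a vertex `v` with `S ∪ {v} ∈ E(G)` such that `v` occupies
the `ℓ`-th position of the ordered edge `S ∪ {v}`. -/
def IsType {V : Type*} [DecidableEq V] (ord : V → ℕ) (G : Finset (Finset V))
    (S : Finset V) (ℓ : ℕ) : Prop :=
  ∃ v, v ∉ S ∧ insert v S ∈ G ∧ rankIn ord (insert v S) v + 1 = ℓ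

/-- The edge `e₁ = {d_{t−k+2}, …, d_t, b_t}` of `F_t^{(k)}`. -/
def e1F (k t : ℕ) : Finset (Vtx k t) :=
  insert (Sum.inr ((0 : Fin 3), Fin.last t))
    ((Finset.univ.filter (fun r : Fin (t + 1) => t + 2 ≤ (r : ℕ) + k)).image
      (fun r => (Sum.inr ((2 : Fin 3), r) : Vtx k t)))

/-- The `(k−1)`-set `S = {d_{t−k+2}, …, d_t}`. -/
def Sset (k t : ℕ) : Finset (Vtx k t) :=
  (Finset.univ.filter (fun r : Fin (t + 1) => t + 2 ≤ (r : ℕ) + k)).image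
    (fun r => (Sum.inr ((2 : Fin 3), r) : Vtx k t))

/-- If `f` maps `e` bijectively onto `{0, …, k-1}` and the elements below `x` are exactly those
with `f`-value below `m`, then `x` has rank `m` in `e`. -/
lemma rankIn_eq_of_image_range {V : Type*} [DecidableEq V] {k m : ℕ} {ord f : V → ℕ}
    {e : Finset V} {x : V} (himg : e.image f = Finset.range k) (hcard : e.card = k)
    (hm : m ≤ k) (hlt : ∀ y ∈ e, ord y < ord x ↔ f y < m) : rankIn ord e x = m := by
  have hinj : Set.InjOn f e := by
    rw [← Finset.card_image_iff, himg, Finset.card_range, hcard]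
  have hfilter : (e.filter fun y => ord y < ord x).image f = Finset.range m := by
    rw [Finset.filter_congr hlt]
    ext n
    have hn := Finset.ext_iff.mp himg n
    simp only [Finset.mem_image, Finset.mem_filter, Finset.mem_range] at hn ⊢
    constructor
    · rintro ⟨y, ⟨-, hy⟩, rfl⟩
      exact hy
    · intro h
      obtain ⟨y, hy, rfl⟩ := hn.mpr (by omega)
      exact ⟨y, ⟨hy, h⟩, rfl⟩
  rw [rankIn, ← Finset.card_image_of_injOn (f := f)
    (hinj.mono (by simp [Set.subset_def]; tauto)), hfilter, Finset.card_range]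

lemma rankIn_eq_label {V : Type*} [DecidableEq V] {k : ℕ} {ord f : V → ℕ}
    {e : Finset V} {x : V} (himg : e.image f = Finset.range k) (hcard : e.card = k)
    (hmono : ∀ y ∈ e, ∀ z ∈ e, f y < f z → ord y < ord z) (hx : x ∈ e) :
    rankIn ord e x = f x := by
  have hinj : Set.InjOn f e := by
    rw [← Finset.card_image_iff, himg, Finset.card_range, hcard]
  have hfx : f x < k := by
    rw [← Finset.mem_range, ← himg]
    exact Finset.mem_image_of_mem f hx
  refine rankIn_eq_of_image_range himg hcard hfx.le fun y hy => ⟨fun h => ?_, hmono y hy x hx⟩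
  rcases lt_trichotomy (f y) (f x) with hlt | heq | hgt
  · exact hlt
  · rw [hinj hy hx heq] at h
    exact absurd h (lt_irrefl _)
  · exact absurd h (hmono x hx y hy hgt).asymm

/-- A hypergraph is vanishing if its edges have order-preserving labellings by `{0, …, k-1}`
which on every `(k-1)`-set of the shadow are determined by that set alone. -/
lemma isVanishing_of_label {V : Type*} [DecidableEq V] {k : ℕ} (hk : 0 < k)
    {F : Finset (Finset V)} {ord : V → ℕ} (lab : Finset V → V → ℕ)
    (h : ∀ e ∈ F, ∃ f : V → ℕ, e.image f = Finset.range k ∧ e.card = k ∧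
      (∀ y ∈ e, ∀ z ∈ e, f y < f z → ord y < ord z) ∧
      ∀ x ∈ e, ∀ v ∈ e.erase x, lab (e.erase x) v = f v) :
    IsVanishing k F ord := by
  refine ⟨fun S => sInf {n | ∀ v ∈ S, lab S v ≠ n} % k, fun S => Nat.mod_lt _ hk, ?_⟩
  intro e he x hx
  obtain ⟨f, himg, hcard, hmono, hlab⟩ := h e he
  have hinj : Set.InjOn f e := by
    rw [← Finset.card_image_iff, himg, Finset.card_range, hcard]
  have hfx : f x < k := by
    rw [← Finset.mem_range, ← himg]
    exact Finset.mem_image_of_mem f hx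
  have hmin : IsLeast {n | ∀ v ∈ e.erase x, lab (e.erase x) v ≠ n} (f x) := by
    constructor
    · intro v hv heq
      rw [hlab x hx v hv] at heq
      exact Finset.ne_of_mem_erase hv (hinj (Finset.mem_of_mem_erase hv) hx heq)
    · intro n hn
      by_contra! hlt
      have hmem : n ∈ e.image f := by
        rw [himg, Finset.mem_range]
        omega
      obtain ⟨y, hy, rfl⟩ := Finset.mem_image.mp hmem
      have hy' : y ∈ e.erase x :=
        Finset.mem_erase.mpr ⟨fun hyx => by simp [hyx] at hlt, hy⟩
      exact hn y hy' (hlab x hx y hy')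
  show sInf {n | ∀ v ∈ e.erase x, lab (e.erase x) v ≠ n} % k = _
  rw [hmin.csInf_eq, Nat.mod_eq_of_lt hfx, rankIn_eq_label himg hcard hmono hx]

lemma isVanishing_singleton {V : Type*} [DecidableEq V] {k : ℕ} {e : Finset V}
    (hk : 0 < k) (hcard : e.card = k) (ord : V → ℕ) : IsVanishing k {e} ord := by
  refine ⟨fun S => (e.filter fun y => ∃ z ∈ e \ S, ord y < ord z).card % k,
    fun S => Nat.mod_lt _ hk, ?_⟩
  intro e' he' x hx
  obtain rfl := Finset.mem_singleton.mp he'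
  have hlt : rankIn ord e' x < k := by
    rw [← hcard]
    refine Finset.card_lt_card (Finset.filter_ssubset.mpr ⟨x, hx, lt_irrefl _⟩)
  have hset : e' \ e'.erase x = {x} := by
    rw [Finset.sdiff_erase hx]
    simp
  simp only [hset, Finset.mem_singleton, exists_eq_left]
  exact Nat.mod_eq_of_lt hlt

/-- The position of a vertex on the path of `F_t^{(k)}` starting with letter `x`. -/
def pathPos (k t : ℕ) (x : Fin 3) : Vtx k t → ℕ
  | Sum.inl q => q
  | Sum.inr (y, r) => if y = x then k - 1 + r else t + k

/-- The edge of `F_t^{(k)}` on the path with letter `x` starting at position `s`. -/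
def pathWindow (k t : ℕ) (x : Fin 3) (s : ℕ) : Finset (Vtx k t) :=
  (Finset.Ico s (s + k)).image (pathSeq k t x)

lemma pathPos_pathSeq {k t : ℕ} (hk : 3 ≤ k) (x : Fin 3) {p : ℕ} (hp : p ≤ t + k) :
    pathPos k t x (pathSeq k t x p) = p := by
  have hx : x + 1 ≠ x := by revert x; decide
  unfold pathSeq
  split_ifs with h1 h2
  · rfl
  · simp only [pathPos, if_true]
    omega
  · simp only [pathPos, if_neg hx]
    omega

lemma pathSeq_of_lt {k t : ℕ} (x : Fin 3) {p : ℕ} (h : p < k - 1) :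
    pathSeq k t x p = Sum.inl ⟨p, h⟩ := by
  simp [pathSeq, h]

lemma pathSeq_add {k t : ℕ} (x : Fin 3) (r : Fin (t + 1)) :
    pathSeq k t x (k - 1 + r) = Sum.inr (x, r) := by
  have hr := r.isLt
  simp [pathSeq, hr]

lemma pathSeq_last {k t : ℕ} (hk : 3 ≤ k) (x : Fin 3) :
    pathSeq k t x (t + k) = Sum.inr (x + 1, Fin.last t) := by
  unfold pathSeq
  rw [dif_neg (by omega), dif_neg (by omega)]

/-- The common rank of the vertices at position `p` in the edges of `F_t^{(k)}`. -/
def residueRank (k t j p : ℕ) : ℕ := (p + (j - 1 + t * (k - 1))) % k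

lemma residueRank_eq {k t j p l : ℕ} (hk : 3 ≤ k) (ht : k - 2 ≤ t) (hj1 : 1 ≤ j) (hj : j ≤ k)
    (hpl : p + l = t + k) (hl : l < 2 * k) :
    (l + 1 ≤ j ∧ residueRank k t j p + l + 1 = j) ∨
    (j ≤ l ∧ l + 1 ≤ j + k ∧ residueRank k t j p + l + 1 = j + k) ∨
    (j + k ≤ l ∧ residueRank k t j p + l + 1 = j + 2 * k) := by
  obtain ⟨t, rfl⟩ : ∃ n, t = n + 1 := ⟨t - 1, by omega⟩
  obtain ⟨k, rfl⟩ : ∃ n, k = n + 1 := ⟨k - 1, by omega⟩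
  clear ht
  have key : ∀ n q, n < k + 1 → p + (j - 1 + (t + 1) * k) = n + (k + 1) * q →
      residueRank (k + 1) (t + 1) j p = n := by
    intro n q hn hq
    rw [residueRank, Nat.add_sub_cancel, hq, Nat.add_mul_mod_self_left, Nat.mod_eq_of_lt hn]
  by_cases h1 : l + 1 ≤ j
  · have := key (j - (l + 1)) (t + 2) (by omega) (by zify [h1, hj1] at *; linarith)
    omega
  · by_cases h2 : l + 1 ≤ j + (k + 1)
    · have := key (j + (k + 1) - (l + 1)) (t + 1) (by omega) (by
        zify [h2, hj1] at *; linarith)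
      omega
    · have := key (j + 2 * (k + 1) - (l + 1)) t (by omega) (by
        have : l + 1 ≤ j + 2 * (k + 1) := by omega
        zify [this, hj1] at *; linarith)
      omega

lemma image_residueRank {k t : ℕ} (j s : ℕ) :
    (Finset.Ico s (s + k)).image (residueRank k t j) = Finset.range k := by
  have h := Nat.image_Ico_mod (s + (j - 1 + t * (k - 1))) k
  rw [← h, show s + (j - 1 + t * (k - 1)) + k = s + k + (j - 1 + t * (k - 1)) by ring,
    ← Finset.image_add_right_Ico, Finset.image_image]
  rfl

lemma image_pathWindow {k t : ℕ} (hk : 3 ≤ k) (j : ℕ) (x : Fin 3) {s : ℕ} (hs : s ≤ t + 1) :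
    (pathWindow k t x s).image (fun v => residueRank k t j (pathPos k t x v)) =
      Finset.range k := by
  rw [← image_residueRank (t := t) j s, pathWindow, Finset.image_image]
  refine Finset.image_congr fun p hp => ?_
  have hp' := Finset.mem_Ico.mp hp
  simp only [Function.comp]
  rw [pathPos_pathSeq hk x (by omega)]

lemma card_pathWindow {k t : ℕ} (hk : 3 ≤ k) (x : Fin 3) {s : ℕ} (hs : s ≤ t + 1) :
    (pathWindow k t x s).card = k := by
  apply le_antisymm
  · simpa [pathWindow] using
      Finset.card_image_le (s := Finset.Ico s (s + k)) (f := pathSeq k t x)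
  · have h := Finset.card_image_le (s := pathWindow k t x s)
      (f := fun v => residueRank k t 1 (pathPos k t x v))
    rwa [image_pathWindow hk 1 x hs, Finset.card_range] at h

lemma mem_Fkt {k t : ℕ} {e : Finset (Vtx k t)} :
    e ∈ Fkt k t ↔ ∃ x s, s ≤ t + 1 ∧ e = pathWindow k t x s := by
  have hwin : ∀ x s, (Finset.range k).image (fun j => pathSeq k t x (s + j)) =
      pathWindow k t x s := by
    intro x s
    ext v
    simp only [pathWindow, Finset.mem_image, Finset.mem_range, Finset.mem_Ico]
    constructor
    · rintro ⟨l, hl, rfl⟩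
      exact ⟨s + l, by omega, rfl⟩
    · rintro ⟨p, hp, rfl⟩
      exact ⟨p - s, by omega, by rw [Nat.add_sub_cancel' hp.1]⟩
  simp only [Fkt, Finset.mem_image, Finset.mem_univ, true_and, hwin]
  constructor
  · rintro ⟨p, rfl⟩
    exact ⟨p.1, p.2, by omega, rfl⟩
  · rintro ⟨x, s, hs, rfl⟩
    exact ⟨(x, ⟨s, by omega⟩), rfl⟩

lemma Sset_eq_image {k t : ℕ} (hk : 3 ≤ k) (ht : k - 2 ≤ t) :
    Sset k t = (Finset.Ico (t + 1) (t + k)).image (pathSeq k t 2) := by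
  ext v
  simp only [Sset, Finset.mem_image, Finset.mem_filter, Finset.mem_univ, true_and,
    Finset.mem_Ico]
  constructor
  · rintro ⟨r, hr, rfl⟩
    exact ⟨k - 1 + r, by omega, pathSeq_add 2 r⟩
  · rintro ⟨p, hp, rfl⟩
    refine ⟨⟨p - (k - 1), by omega⟩, by simp only; omega, ?_⟩
    rw [← pathSeq_add]
    congr 1
    simp only
    omega

lemma insert_Sset_eq_pathWindow {k t : ℕ} (hk : 3 ≤ k) (ht : k - 2 ≤ t) :
    insert (pathSeq k t 2 t) (Sset k t) = pathWindow k t 2 t := by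
  rw [Sset_eq_image hk ht, ← Finset.image_insert, pathWindow]
  congr 1
  ext p
  simp only [Finset.mem_insert, Finset.mem_Ico]
  omega

lemma e1F_eq_pathWindow {k t : ℕ} (hk : 3 ≤ k) (ht : k - 2 ≤ t) :
    e1F k t = pathWindow k t 2 (t + 1) := by
  have h : e1F k t = insert (pathSeq k t 2 (t + k)) (Sset k t) := by
    rw [pathSeq_last hk]
    rfl
  rw [h, Sset_eq_image hk ht, ← Finset.image_insert, pathWindow]
  congr 1
  ext p
  simp only [Finset.mem_insert, Finset.mem_Ico]
  omega

lemma pathSeq_notMem_Sset {k t p : ℕ} (hk : 3 ≤ k) (ht : k - 2 ≤ t)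
    (hp : p ≤ t ∨ p = t + k) : pathSeq k t 2 p ∉ Sset k t := by
  rw [Sset_eq_image hk ht]
  intro h
  obtain ⟨q, hq, heq⟩ := Finset.mem_image.mp h
  have hq' := Finset.mem_Ico.mp hq
  have := congrArg (pathPos k t 2) heq
  rw [pathPos_pathSeq hk 2 (by omega), pathPos_pathSeq hk 2 (by omega)] at this
  omega

/-- The main key of the ordering: the residue rank of the vertex on its own path, except that
the last `j - i` vertices with letter `b` are pushed down to the key `i - 1`. -/
def orderKey (k t i j : ℕ) : Vtx k t → ℕ
  | Sum.inl q => residueRank k t j q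
  | Sum.inr (y, r) =>
      if y = 0 ∧ t + 1 ≤ r + (j - i) then i - 1 else residueRank k t j (k - 1 + r)

/-- The tie-breaking key of the ordering: first the letter `a`, then `b`, `c` and `d`. -/
def tieKey (k t : ℕ) : Vtx k t → ℕ
  | Sum.inl q => q
  | Sum.inr (y, r) => k + y * (t + 1) + r

/-- The lexicographic ordering by `orderKey` and `tieKey`. -/
def vtxOrd (k t i j : ℕ) (v : Vtx k t) : ℕ :=
  orderKey k t i j v * (k + 3 * (t + 1)) + tieKey k t v

lemma tieKey_lt {k t : ℕ} (v : Vtx k t) : tieKey k t v < k + 3 * (t + 1) := by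
  rcases v with q | ⟨y, r⟩
  · simp only [tieKey]
    omega
  · fin_cases y <;> simp [tieKey] <;> omega

lemma tieKey_injective {k t : ℕ} : Function.Injective (tieKey k t) := by
  rintro (q | ⟨y, r⟩) (q' | ⟨y', r'⟩) h
  · exact congrArg _ (Fin.ext h)
  · simp only [tieKey] at h
    omega
  · simp only [tieKey] at h
    omega
  · fin_cases y <;> fin_cases y' <;> simp [tieKey] at h ⊢ <;> omega

lemma vtxOrd_lt_iff {k t i j : ℕ} {v w : Vtx k t} :
    vtxOrd k t i j v < vtxOrd k t i j w ↔ orderKey k t i j v < orderKey k t i j w ∨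
      (orderKey k t i j v = orderKey k t i j w ∧ tieKey k t v < tieKey k t w) := by
  have hv := tieKey_lt v
  have hw := tieKey_lt w
  unfold vtxOrd
  rcases lt_trichotomy (orderKey k t i j v) (orderKey k t i j w) with h | h | h
  · have := Nat.mul_le_mul_right (k + 3 * (t + 1)) (Nat.succ_le_of_lt h)
    rw [Nat.succ_mul] at this
    exact ⟨fun _ => Or.inl h, fun _ => by omega⟩
  · rw [h]
    simp
  · have := Nat.mul_le_mul_right (k + 3 * (t + 1)) (Nat.succ_le_of_lt h)
    rw [Nat.succ_mul] at this
    exact ⟨fun _ => by omega, fun _ => by omega⟩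

lemma vtxOrd_injective {k t i j : ℕ} : Function.Injective (vtxOrd k t i j) := by
  intro v w h
  have h1 := (vtxOrd_lt_iff (i := i) (j := j) (v := v) (w := w)).not.mp h.not_lt
  have h2 := (vtxOrd_lt_iff (i := i) (j := j) (v := w) (w := v)).not.mp h.not_gt
  exact tieKey_injective (by omega)

lemma orderKey_pathSeq {k t i j p : ℕ} (ht : k - 2 ≤ t) (hi : 1 ≤ i) (hj : j ≤ k) (x : Fin 3)
    (hp : p < t + k) : orderKey k t i j (pathSeq k t x p) =
      if x = 0 ∧ t + k ≤ p + (j - i) then i - 1 else residueRank k t j p := by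
  by_cases h : p < k - 1
  · rw [pathSeq_of_lt x h, if_neg (by omega)]
    rfl
  · obtain ⟨r, rfl⟩ : ∃ r : Fin (t + 1), p = k - 1 + r :=
      ⟨⟨p - (k - 1), by omega⟩, by simp only; omega⟩
    rw [pathSeq_add]
    simp only [orderKey]
    congr 1
    apply propext
    refine and_congr_right fun _ => ?_
    omega

lemma vtxOrd_pathSeq_lt {k t i j s p q : ℕ} (hk : 3 ≤ k) (ht : k - 2 ≤ t) (hi : 1 ≤ i)
    (hij : i < j) (hj : j ≤ k) (x : Fin 3) (hs : s ≤ t + 1) (hne : x = 2 → s ≠ t + 1)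
    (hp : p ∈ Finset.Ico s (s + k)) (hq : q ∈ Finset.Ico s (s + k))
    (hlt : residueRank k t j p < residueRank k t j q) :
    vtxOrd k t i j (pathSeq k t x p) < vtxOrd k t i j (pathSeq k t x q) := by
  rw [Finset.mem_Ico] at hp hq
  rw [vtxOrd_lt_iff]
  have rank_window := fun (p : ℕ) (hp : t + 1 ≤ p ∧ p ≤ t + k) =>
    residueRank_eq (p := p) (l := t + k - p) hk ht (by omega : 1 ≤ j) hj (by omega) (by omega)
  have key_last : p = t + k ∨ q = t + k →
      orderKey k t i j (pathSeq k t x (t + k)) + 2 = j := by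
    intro h
    have hx : x + 1 ≠ 0 := by
      have : x ≠ 2 := fun h2 => hne h2 (by omega)
      omega
    have hrank := rank_window (k - 1 + t) (by omega)
    rw [pathSeq_last hk]
    simp only [orderKey, hx, false_and, if_false, Fin.val_last]
    omega
  by_cases hpl : p = t + k
  · subst hpl
    have hkey := key_last (Or.inl rfl)
    have hqk : q < t + k := by
      rcases eq_or_ne q (t + k) with rfl | h
      · exact absurd hlt (lt_irrefl _)
      · omega
    have hrp := rank_window (t + k) (by omega)
    have hrq := rank_window q (by omega)
    left
    rw [orderKey_pathSeq ht hi hj x hqk]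
    split_ifs <;> omega
  by_cases hql : q = t + k
  · subst hql
    have hkey := key_last (Or.inr rfl)
    have hrp := rank_window p (by omega)
    have hrq := rank_window (t + k) (by omega)
    have htie : tieKey k t (pathSeq k t x p) < tieKey k t (pathSeq k t x (t + k)) := by
      obtain ⟨r, rfl⟩ : ∃ r : Fin (t + 1), p = k - 1 + r :=
        ⟨⟨p - (k - 1), by omega⟩, by simp only; omega⟩
      have hx : x ≠ 2 := fun h2 => hne h2 (by omega)
      rw [pathSeq_last hk, pathSeq_add]
      fin_cases x <;> simp [tieKey] at hx ⊢ <;> omega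
    have hle : orderKey k t i j (pathSeq k t x p) + 2 ≤ j := by
      rw [orderKey_pathSeq ht hi hj x (by omega)]
      split_ifs <;> omega
    omega
  rw [orderKey_pathSeq ht hi hj x (by omega), orderKey_pathSeq ht hi hj x (by omega)]
  have hrp := fun h => residueRank_eq (p := p) (l := t + k - p) hk ht (by omega : 1 ≤ j) hj
    (by omega) h
  have hrq := fun h => residueRank_eq (p := q) (l := t + k - q) hk ht (by omega : 1 ≤ j) hj
    (by omega) h
  split_ifs with h1 h2 h2
  · right
    refine ⟨rfl, ?_⟩
    specialize hrp (by omega)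
    specialize hrq (by omega)
    obtain ⟨r, rfl⟩ : ∃ r : Fin (t + 1), p = k - 1 + r :=
      ⟨⟨p - (k - 1), by omega⟩, by simp only; omega⟩
    obtain ⟨r', rfl⟩ : ∃ r : Fin (t + 1), q = k - 1 + r :=
      ⟨⟨q - (k - 1), by omega⟩, by simp only; omega⟩
    rw [pathSeq_add, pathSeq_add]
    simp only [tieKey]
    omega
  · specialize hrp (by omega)
    omega
  · specialize hrp (by omega)
    specialize hrq (by omega)
    omega
  · exact Or.inl hlt

/-- The label of a vertex `v` read off from a set `S` of the shadow: the residue rank of `v` on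
its own path, or on the preceding path if `S` meets that path outside the letter `a` and `v` is the
last vertex of its letter. -/
def shadowLabel (k t j : ℕ) (S : Finset (Vtx k t)) : Vtx k t → ℕ
  | Sum.inl q => residueRank k t j q
  | Sum.inr (y, r) =>
      if r = Fin.last t ∧ ∃ z r', z + 1 = y ∧ Sum.inr (z, r') ∈ S then residueRank k t j (t + k)
      else residueRank k t j (k - 1 + r)

lemma shadowLabel_erase {k t j s : ℕ} (hk : 3 ≤ k) (ht : k - 2 ≤ t) (x : Fin 3)
    (hs : s ≤ t + 1) {w v : Vtx k t} (hw : w ∈ pathWindow k t x s)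
    (hv : v ∈ (pathWindow k t x s).erase w) :
    shadowLabel k t j ((pathWindow k t x s).erase w) v =
      residueRank k t j (pathPos k t x v) := by
  obtain ⟨p, hp, rfl⟩ := Finset.mem_image.mp hw
  obtain ⟨q, hq, rfl⟩ := Finset.mem_image.mp (Finset.mem_of_mem_erase hv)
  rw [Finset.mem_Ico] at hp hq
  rw [pathPos_pathSeq hk x (by omega)]
  by_cases hqk : q < k - 1
  · rw [pathSeq_of_lt x hqk]
    rfl
  by_cases hql : q < t + k
  · obtain ⟨r, rfl⟩ : ∃ r : Fin (t + 1), q = k - 1 + r :=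
      ⟨⟨q - (k - 1), by omega⟩, by simp only; omega⟩
    rw [pathSeq_add]
    simp only [shadowLabel]
    rw [if_neg]
    rintro ⟨-, z, r', hz, hmem⟩
    obtain ⟨m, -, hm⟩ := Finset.mem_image.mp (Finset.mem_of_mem_erase hmem)
    unfold pathSeq at hm
    split_ifs at hm
    · have : x = z := by simpa using congrArg (Prod.fst) (Sum.inr_injective hm)
      omega
    · have : x + 1 = z := by simpa using congrArg (Prod.fst) (Sum.inr_injective hm)
      omega
  · obtain rfl : q = t + k := by omega
    obtain ⟨m, hm1, hm2, hmp⟩ : ∃ m, t + 1 ≤ m ∧ m < t + k ∧ m ≠ p := by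
      by_cases h : p = t + 1
      · exact ⟨t + 2, by omega, by omega, by omega⟩
      · exact ⟨t + 1, by omega, by omega, by omega⟩
    rw [pathSeq_last hk]
    simp only [shadowLabel]
    rw [if_pos]
    refine ⟨trivial, x, ⟨m - (k - 1), by omega⟩, rfl, ?_⟩
    have hseq : pathSeq k t x m = Sum.inr (x, ⟨m - (k - 1), by omega⟩) := by
      rw [← pathSeq_add]
      congr 1
      simp only
      omega
    rw [← hseq, Finset.mem_erase]
    refine ⟨fun heq => ?_, Finset.mem_image_of_mem _ (by rw [Finset.mem_Ico]; omega)⟩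
    have := congrArg (pathPos k t x) heq
    rw [pathPos_pathSeq hk x (by omega), pathPos_pathSeq hk x (by omega)] at this
    exact hmp this

lemma vtxOrd_lt_of_label_lt {k t i j s : ℕ} (hk : 3 ≤ k) (ht : k - 2 ≤ t) (hi : 1 ≤ i)
    (hij : i < j) (hj : j ≤ k) (x : Fin 3) (hs : s ≤ t + 1) (hne : x = 2 → s ≠ t + 1) :
    ∀ y ∈ pathWindow k t x s, ∀ z ∈ pathWindow k t x s,
      residueRank k t j (pathPos k t x y) < residueRank k t j (pathPos k t x z) →
        vtxOrd k t i j y < vtxOrd k t i j z := by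
  intro y hy z hz h
  obtain ⟨p, hp, rfl⟩ := Finset.mem_image.mp hy
  obtain ⟨q, hq, rfl⟩ := Finset.mem_image.mp hz
  have hp' := Finset.mem_Ico.mp hp
  have hq' := Finset.mem_Ico.mp hq
  rw [pathPos_pathSeq hk x (by omega), pathPos_pathSeq hk x (by omega)] at h
  exact vtxOrd_pathSeq_lt hk ht hi hij hj x hs hne hp hq h

lemma isVanishing_Fkt_sdiff {k t i j : ℕ} (hk : 3 ≤ k) (ht : k - 2 ≤ t) (hi : 1 ≤ i)
    (hij : i < j) (hj : j ≤ k) :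
    IsVanishing k (Fkt k t \ {e1F k t}) (vtxOrd k t i j) := by
  refine isVanishing_of_label (by omega) (shadowLabel k t j) fun e he => ?_
  rw [Finset.mem_sdiff, Finset.mem_singleton] at he
  obtain ⟨x, s, hs, rfl⟩ := mem_Fkt.mp he.1
  refine ⟨fun v => residueRank k t j (pathPos k t x v), image_pathWindow hk j x hs,
    card_pathWindow hk x hs, vtxOrd_lt_of_label_lt hk ht hi hij hj x hs ?_,
    fun w hw v hv => shadowLabel_erase hk ht x hs hw hv⟩
  rintro rfl rfl
  exact he.2 (e1F_eq_pathWindow hk ht).symm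

lemma rankIn_e1F {k t i j : ℕ} (hk : 3 ≤ k) (ht : k - 2 ≤ t) (hi : 1 ≤ i)
    (hij : i < j) (hj : j ≤ k) :
    rankIn (vtxOrd k t i j) (e1F k t) (Sum.inr (0, Fin.last t)) = i - 1 := by
  rw [e1F_eq_pathWindow hk ht]
  refine rankIn_eq_of_image_range (image_pathWindow hk j 2 le_rfl)
    (card_pathWindow hk 2 le_rfl) (by omega) fun y hy => ?_
  obtain ⟨p, hp, rfl⟩ := Finset.mem_image.mp hy
  rw [Finset.mem_Ico] at hp
  rw [pathPos_pathSeq hk 2 (by omega), vtxOrd_lt_iff]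
  have hkey : orderKey k t i j (Sum.inr (0, Fin.last t)) = i - 1 := by
    simp only [orderKey, true_and, Fin.val_last]
    rw [if_pos (by omega)]
  by_cases hpl : p = t + k
  · subst hpl
    have hrank := residueRank_eq (p := t + k) (l := 0) hk ht (by omega : 1 ≤ j) hj rfl (by omega)
    rw [pathSeq_last hk]
    simp
    omega
  · obtain ⟨r, rfl⟩ : ∃ r : Fin (t + 1), p = k - 1 + r :=
      ⟨⟨p - (k - 1), by omega⟩, by simp only; omega⟩
    rw [orderKey_pathSeq ht hi hj 2 (by omega), hkey, if_neg (by simp), pathSeq_add]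
    simp [tieKey]
    omega

/-- For `F_t^{(k)}` (`k ≥ 3`, `t ≥ k−2`) with `e₁ = {d_{t−k+2},…,d_t,b_t}`,
let `F₁` be the spanning subhypergraph with the single edge `e₁` and `F₂ = F_t^{(k)} − e₁`.
For every pair `i < j` in `[k]` there is a vertex ordering of `F_t^{(k)}` that is
vanishing for both `F₁` and `F₂` and under which `S = {d_{t−k+2},…,d_t}` is `i`-type
with respect to `F₁` and `j`-type with respect to `F₂`. -/
theorem stmt17 (k t : ℕ) (hk : 3 ≤ k) (ht : k - 2 ≤ t)
    (i j : ℕ) (hi : 1 ≤ i) (hij : i < j) (hj : j ≤ k) :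
    ∃ ord : Vtx k t → ℕ, Function.Injective ord ∧
      IsVanishing k {e1F k t} ord ∧
      IsVanishing k (Fkt k t \ {e1F k t}) ord ∧
      IsType ord {e1F k t} (Sset k t) i ∧
      IsType ord (Fkt k t \ {e1F k t}) (Sset k t) j := by
  have hnot : pathSeq k t 2 t ∉ Sset k t := pathSeq_notMem_Sset hk ht (Or.inl le_rfl)
  have hlast : pathSeq k t 2 (t + k) = Sum.inr (0, Fin.last t) := pathSeq_last hk 2
  have hnot' : (Sum.inr (0, Fin.last t) : Vtx k t) ∉ Sset k t :=
    hlast ▸ pathSeq_notMem_Sset hk ht (Or.inr rfl)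
  refine ⟨vtxOrd k t i j, vtxOrd_injective, isVanishing_singleton (by omega) ?_ _,
    isVanishing_Fkt_sdiff hk ht hi hij hj,
    ⟨Sum.inr (0, Fin.last t), hnot', Finset.mem_singleton_self _, ?_⟩,
    ⟨pathSeq k t 2 t, hnot, ?_, ?_⟩⟩
  · rw [e1F_eq_pathWindow hk ht, card_pathWindow hk 2 le_rfl]
  · have := rankIn_e1F hk ht hi hij hj
    rw [e1F] at this
    rw [Sset, this]
    omega
  · rw [Finset.mem_sdiff, Finset.mem_singleton]
    refine ⟨mem_Fkt.mpr ⟨2, t, by omega, insert_Sset_eq_pathWindow hk ht⟩, fun heq => ?_⟩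
    have hmem : Sum.inr (0, Fin.last t) ∈ insert (pathSeq k t 2 t) (Sset k t) := by
      rw [heq]
      exact Finset.mem_insert_self _ _
    rcases Finset.mem_insert.mp hmem with h | h
    · have := congrArg (pathPos k t 2) (hlast.trans h)
      rw [pathPos_pathSeq hk 2 le_rfl, pathPos_pathSeq hk 2 (by omega)] at this
      omega
    · exact hnot' h
  · have hmem : pathSeq k t 2 t ∈ pathWindow k t 2 t :=
      Finset.mem_image_of_mem _ (by rw [Finset.mem_Ico]; omega)
    rw [insert_Sset_eq_pathWindow hk ht, rankIn_eq_label (image_pathWindow hk j 2 (by omega))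
      (card_pathWindow hk 2 (by omega))
      (vtxOrd_lt_of_label_lt hk ht hi hij hj 2 (by omega) (by omega)) hmem,
      pathPos_pathSeq hk 2 (by omega)]
    have := residueRank_eq (p := t) (l := k) hk ht (by omega : 1 ≤ j) hj rfl (by omega)
    omega

end
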